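/- arXiv:1906.09161 — 5 statements merged into one kernel-verified Lean document; each statement's English description precedes it below -/
import Mathlib

section
/- Let (Y, Z̃) be a fuzzy Pareto solution of FMCLP. Then there exists Z : I → ℝ with Zᵢ ∈ [Z⁻ᵢ, Z⁺ᵢ] for every i ∈ I (in fact Zᵢ = Z⁺ᵢ works) such that the crisp solution (Y, Z), i.e. the fuzzy solution (Y, (Z, Z, Z)), is feasible for FMCLP and its objective triple equals that of (Y, Z̃): (∑ᵢ w⁻ᵢ Zᵢ, ∑ᵢ wᵢ Zᵢ, ∑ᵢ w⁺ᵢ Zᵢ) = (∑ᵢ w⁻ᵢ Z⁻ᵢ, ∑ᵢ wᵢ Ẑᵢ, ∑ᵢ w⁺ᵢ Z⁺ᵢ). -/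
/-- Feasibility for the mixed-binary multiobjective problem MMCLP:
`y : J → ℝ` takes values in `{0,1}`, `z : I → ℝ` takes values in `[0,1]`,
the three budget constraints hold, and each coverage constraint holds. -/
def MMFeas {I J : Type*} [Fintype I] [Fintype J]
    (flo f fhi : J → ℝ) (Blo B Bhi : ℝ) (Jt : I → Finset J)
    (y : J → ℝ) (z : I → ℝ) : Prop :=
  (∀ j, y j = 0 ∨ y j = 1) ∧ (∀ i, 0 ≤ z i ∧ z i ≤ 1) ∧
  (∑ j, flo j * y j) ≤ Blo ∧ (∑ j, f j * y j) ≤ B ∧ (∑ j, fhi j * y j) ≤ Bhi ∧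
  ∀ i, z i ≤ ∑ j ∈ Jt i, y j

/-- `(y, z)` is a Pareto solution of MMCLP with objectives
`F₁(z) = ∑ w⁻ᵢ zᵢ`, `F₂(z) = ∑ wᵢ zᵢ`, `F₃(z) = ∑ w⁺ᵢ zᵢ`. -/
def MMPareto {I J : Type*} [Fintype I] [Fintype J]
    (wlo w whi : I → ℝ) (flo f fhi : J → ℝ) (Blo B Bhi : ℝ) (Jt : I → Finset J)
    (y : J → ℝ) (z : I → ℝ) : Prop :=
  MMFeas flo f fhi Blo B Bhi Jt y z ∧
  ¬ ∃ y' z', MMFeas flo f fhi Blo B Bhi Jt y' z' ∧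
    (∑ i, wlo i * z i) ≤ (∑ i, wlo i * z' i) ∧
    (∑ i, w i * z i) ≤ (∑ i, w i * z' i) ∧
    (∑ i, whi i * z i) ≤ (∑ i, whi i * z' i) ∧
    ((∑ i, wlo i * z' i), (∑ i, w i * z' i), (∑ i, whi i * z' i)) ≠
      ((∑ i, wlo i * z i), (∑ i, w i * z i), (∑ i, whi i * z i))

/-- Feasibility of a fuzzy solution `(y, (Z⁻, Ẑ, Z⁺))` of FMCLP (triangular form). -/
def FuzzyFeas {I J : Type*} [Fintype I] [Fintype J]
    (flo f fhi : J → ℝ) (Blo B Bhi : ℝ) (Jt : I → Finset J)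
    (y : J → ℝ) (Zlo Zmid Zhi : I → ℝ) : Prop :=
  (∀ j, y j = 0 ∨ y j = 1) ∧
  (∀ i, 0 ≤ Zlo i ∧ Zlo i ≤ Zmid i ∧ Zmid i ≤ Zhi i ∧ Zhi i ≤ 1) ∧
  (∑ j, flo j * y j) ≤ Blo ∧ (∑ j, f j * y j) ≤ B ∧ (∑ j, fhi j * y j) ≤ Bhi ∧
  ∀ i, Zhi i ≤ ∑ j ∈ Jt i, y j

/-- `(y, (Z⁻, Ẑ, Z⁺))` is a fuzzy Pareto solution of FMCLP, where the objective
triple is `G(Z̃) = (∑ w⁻ᵢ Z⁻ᵢ, ∑ wᵢ Ẑᵢ, ∑ w⁺ᵢ Z⁺ᵢ)`. -/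
def FuzzyPareto {I J : Type*} [Fintype I] [Fintype J]
    (wlo w whi : I → ℝ) (flo f fhi : J → ℝ) (Blo B Bhi : ℝ) (Jt : I → Finset J)
    (y : J → ℝ) (Zlo Zmid Zhi : I → ℝ) : Prop :=
  FuzzyFeas flo f fhi Blo B Bhi Jt y Zlo Zmid Zhi ∧
  ¬ ∃ y' Zlo' Zmid' Zhi', FuzzyFeas flo f fhi Blo B Bhi Jt y' Zlo' Zmid' Zhi' ∧
    (∑ i, wlo i * Zlo i) ≤ (∑ i, wlo i * Zlo' i) ∧
    (∑ i, w i * Zmid i) ≤ (∑ i, w i * Zmid' i) ∧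
    (∑ i, whi i * Zhi i) ≤ (∑ i, whi i * Zhi' i) ∧
    ((∑ i, wlo i * Zlo' i), (∑ i, w i * Zmid' i), (∑ i, whi i * Zhi' i)) ≠
      ((∑ i, wlo i * Zlo i), (∑ i, w i * Zmid i), (∑ i, whi i * Zhi i))

/-- If `(Y, Z̃)` is a fuzzy Pareto solution of FMCLP, then there is a
crisp `Z : I → ℝ` with `Zᵢ ∈ [Z⁻ᵢ, Z⁺ᵢ]` such that `(Y, (Z,Z,Z))` is feasible for FMCLP
and its objective triple equals that of `(Y, Z̃)`. -/
theorem stmt_0 {I J : Type*} [Fintype I] [Fintype J]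
    (wlo w whi : I → ℝ) (flo f fhi : J → ℝ) (Blo B Bhi : ℝ) (Jt : I → Finset J)
    (hw : ∀ i, 0 ≤ wlo i ∧ wlo i ≤ w i ∧ w i ≤ whi i)
    (Y : J → ℝ) (Zlo Zmid Zhi : I → ℝ)
    (hP : FuzzyPareto wlo w whi flo f fhi Blo B Bhi Jt Y Zlo Zmid Zhi) :
    ∃ Z : I → ℝ, (∀ i, Zlo i ≤ Z i ∧ Z i ≤ Zhi i) ∧
      FuzzyFeas flo f fhi Blo B Bhi Jt Y Z Z Z ∧
      (∑ i, wlo i * Z i) = (∑ i, wlo i * Zlo i) ∧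
      (∑ i, w i * Z i) = (∑ i, w i * Zmid i) ∧
      (∑ i, whi i * Z i) = (∑ i, whi i * Zhi i) := by
  obtain ⟨⟨hY, hZ, hBlo, hB, hBhi, hcov⟩, hmax⟩ := hP
  have hfeas : FuzzyFeas flo f fhi Blo B Bhi Jt Y Zhi Zhi Zhi :=
    ⟨hY, fun i => ⟨by linarith [hZ i], le_rfl, le_rfl, by linarith [hZ i]⟩,
      hBlo, hB, hBhi, hcov⟩
  have hlo : (∑ i, wlo i * Zlo i) ≤ ∑ i, wlo i * Zhi i :=
    Finset.sum_le_sum fun i _ =>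
      mul_le_mul_of_nonneg_left (by linarith [hZ i]) (hw i).1
  have hmid : (∑ i, w i * Zmid i) ≤ ∑ i, w i * Zhi i :=
    Finset.sum_le_sum fun i _ =>
      mul_le_mul_of_nonneg_left (hZ i).2.2.1 ((hw i).1.trans (hw i).2.1)
  have heq := by_contra fun hne =>
    hmax ⟨Y, Zhi, Zhi, Zhi, hfeas, hlo, hmid, le_rfl, hne⟩
  exact ⟨Zhi, fun i => ⟨by linarith [hZ i], le_rfl⟩, hfeas, by simpa only [Prod.mk.injEq] using heq⟩
end

section
/- Let y : J → ℝ take values in {0,1} and z : I → ℝ take values in [0,1]. Then (y, (z, z, z)) is a fuzzy Pareto solution of FMCLP if and only if (y, z) is a Pareto solution of MMCLP with respect to the three objectives (F₁(z), F₂(z), F₃(z)) = (∑ᵢ w⁻ᵢ zᵢ, ∑ᵢ wᵢ zᵢ, ∑ᵢ w⁺ᵢ zᵢ). -/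
/-- For crisp `(y, z)` (with `y` binary and `z ∈ [0,1]`), `(y,(z,z,z))`
is a fuzzy Pareto solution of FMCLP iff `(y, z)` is a Pareto solution of MMCLP. -/
theorem stmt_1 {I J : Type*} [Fintype I] [Fintype J]
    (wlo w whi : I → ℝ) (flo f fhi : J → ℝ) (Blo B Bhi : ℝ) (Jt : I → Finset J)
    (hw : ∀ i, 0 ≤ wlo i ∧ wlo i ≤ w i ∧ w i ≤ whi i)
    (y : J → ℝ) (z : I → ℝ)
    (hy : ∀ j, y j = 0 ∨ y j = 1) (hz : ∀ i, 0 ≤ z i ∧ z i ≤ 1) :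
    FuzzyPareto wlo w whi flo f fhi Blo B Bhi Jt y z z z ↔
      MMPareto wlo w whi flo f fhi Blo B Bhi Jt y z := by
  have sum_mono (v a b : I → ℝ) (hv : ∀ i, 0 ≤ v i) (hab : ∀ i, a i ≤ b i) :
      (∑ i, v i * a i) ≤ ∑ i, v i * b i :=
    Finset.sum_le_sum fun i _ => mul_le_mul_of_nonneg_left (hab i) (hv i)
  constructor
  · rintro ⟨⟨-, -, hlo, hmid, hhi, hcov⟩, hpareto⟩
    refine ⟨⟨hy, hz, hlo, hmid, hhi, hcov⟩, ?_⟩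
    rintro ⟨y', z', ⟨hy', hz', hbudget⟩, hdom⟩
    exact hpareto ⟨y', z', z', z',
      ⟨hy', fun i => ⟨(hz' i).1, le_rfl, le_rfl, (hz' i).2⟩, hbudget⟩, hdom⟩
  · rintro ⟨⟨-, -, hbudget⟩, hpareto⟩
    refine ⟨⟨hy, fun i => ⟨(hz i).1, le_rfl, le_rfl, (hz i).2⟩, hbudget⟩, ?_⟩
    rintro ⟨y', Zlo, Zmid, Zhi, ⟨hy', hZ, hbudget'⟩, h₁, h₂, h₃, hne⟩
    -- The crisp solution given by the upper endpoints dominates the fuzzy one.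
    have hlo := sum_mono wlo Zlo Zhi (fun i => (hw i).1)
      fun i => (hZ i).2.1.trans (hZ i).2.2.1
    have hmid := sum_mono w Zmid Zhi (fun i => (hw i).1.trans (hw i).2.1)
      fun i => (hZ i).2.2.1
    refine hpareto ⟨y', Zhi,
      ⟨hy', fun i => ⟨(hZ i).1.trans ((hZ i).2.1.trans (hZ i).2.2.1), (hZ i).2.2.2⟩, hbudget'⟩,
      h₁.trans hlo, h₂.trans hmid, h₃, fun heq => hne ?_⟩
    simp only [Prod.mk.injEq] at heq ⊢
    exact ⟨le_antisymm (hlo.trans heq.1.le) h₁, le_antisymm (hmid.trans heq.2.1.le) h₂, heq.2.2⟩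
end

section
/- Let (Y, Z) be a weakly Pareto solution of MMCLP, and let (δ*, Y*, Z*) be an optimal solution of the test problem P(Y,Z): maximize δ₁ + δ₂ + δ₃ over all (δ, y, z) with (y, z) feasible for MMCLP, δᵣ ≥ 0 and Fᵣ(z) − δᵣ = Fᵣ(Z) for r = 1,2,3. If δ*ᵣ > 0 for some r ∈ {1,2,3}, then (Y*, Z*) is a Pareto solution of MMCLP. -/
/-- `(y, z)` is a weakly Pareto solution of MMCLP. -/
def MMWeakPareto {I J : Type*} [Fintype I] [Fintype J]
    (wlo w whi : I → ℝ) (flo f fhi : J → ℝ) (Blo B Bhi : ℝ) (Jt : I → Finset J)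
    (y : J → ℝ) (z : I → ℝ) : Prop :=
  MMFeas flo f fhi Blo B Bhi Jt y z ∧
  ¬ ∃ y' z', MMFeas flo f fhi Blo B Bhi Jt y' z' ∧
    (∑ i, wlo i * z i) < (∑ i, wlo i * z' i) ∧
    (∑ i, w i * z i) < (∑ i, w i * z' i) ∧
    (∑ i, whi i * z i) < (∑ i, whi i * z' i)

/-- If `(Y, Z)` is weakly Pareto for MMCLP and `(δ*, Y*, Z*)` is an
optimal solution of the Pareto-optimality test problem `P(Y,Z)`, with `δ*ᵣ > 0` for some
`r`, then `(Y*, Z*)` is a Pareto solution of MMCLP. -/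
theorem stmt_3 {I J : Type*} [Fintype I] [Fintype J]
    (wlo w whi : I → ℝ) (flo f fhi : J → ℝ) (Blo B Bhi : ℝ) (Jt : I → Finset J)
    (Y : J → ℝ) (Z : I → ℝ)
    (hweak : MMWeakPareto wlo w whi flo f fhi Blo B Bhi Jt Y Z)
    (d1 d2 d3 : ℝ) (Ys : J → ℝ) (Zs : I → ℝ)
    (hfeas : MMFeas flo f fhi Blo B Bhi Jt Ys Zs)
    (hd1 : 0 ≤ d1) (hd2 : 0 ≤ d2) (hd3 : 0 ≤ d3)
    (he1 : (∑ i, wlo i * Zs i) - d1 = ∑ i, wlo i * Z i)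
    (he2 : (∑ i, w i * Zs i) - d2 = ∑ i, w i * Z i)
    (he3 : (∑ i, whi i * Zs i) - d3 = ∑ i, whi i * Z i)
    (hopt : ∀ (e1 e2 e3 : ℝ) (y : J → ℝ) (z : I → ℝ),
      MMFeas flo f fhi Blo B Bhi Jt y z →
      0 ≤ e1 → 0 ≤ e2 → 0 ≤ e3 →
      (∑ i, wlo i * z i) - e1 = (∑ i, wlo i * Z i) →
      (∑ i, w i * z i) - e2 = (∑ i, w i * Z i) →
      (∑ i, whi i * z i) - e3 = (∑ i, whi i * Z i) →
      e1 + e2 + e3 ≤ d1 + d2 + d3)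
    (hpos : 0 < d1 ∨ 0 < d2 ∨ 0 < d3) :
    MMPareto wlo w whi flo f fhi Blo B Bhi Jt Ys Zs := by
  refine ⟨hfeas, ?_⟩
  rintro ⟨y', z', hf, h1, h2, h3, hne⟩
  have h := hopt _ _ _ y' z' hf
    (show 0 ≤ (∑ i, wlo i * z' i) - ∑ i, wlo i * Z i by linarith)
    (show 0 ≤ (∑ i, w i * z' i) - ∑ i, w i * Z i by linarith)
    (show 0 ≤ (∑ i, whi i * z' i) - ∑ i, whi i * Z i by linarith)
    (sub_sub_cancel _ _) (sub_sub_cancel _ _) (sub_sub_cancel _ _)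
  apply hne
  simp only [Prod.mk.injEq]
  refine ⟨?_, ?_, ?_⟩ <;> linarith
end

section
/- Let (Y, Z) be a weakly Pareto solution of MMCLP, and let (δ*, Y*, Z*) be an optimal solution of the test problem P(Y,Z): maximize δ₁ + δ₂ + δ₃ over all (δ, y, z) with (y, z) feasible for MMCLP, δᵣ ≥ 0 and Fᵣ(z) − δᵣ = Fᵣ(Z) for r = 1,2,3. If δ*ᵣ > 0 for some r ∈ {1,2,3}, then the fuzzy solution (Y*, (Z*, Z*, Z*)) is a fuzzy Pareto solution of FMCLP. -/
/-- The upper component of a fuzzy feasible solution is crisp feasible. -/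
theorem FuzzyFeas.mmFeas_hi {I J : Type*} [Fintype I] [Fintype J]
    {flo f fhi : J → ℝ} {Blo B Bhi : ℝ} {Jt : I → Finset J}
    {y : J → ℝ} {Zlo Zmid Zhi : I → ℝ}
    (h : FuzzyFeas flo f fhi Blo B Bhi Jt y Zlo Zmid Zhi) :
    MMFeas flo f fhi Blo B Bhi Jt y Zhi := by
  obtain ⟨hy, hZ, hbudget⟩ := h
  refine ⟨hy, fun i => ?_, hbudget⟩
  obtain ⟨h0, hlm, hmh, h1⟩ := hZ i
  exact ⟨h0.trans (hlm.trans hmh), h1⟩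

/-- A crisp feasible solution is fuzzy feasible. -/
theorem MMFeas.fuzzyFeas {I J : Type*} [Fintype I] [Fintype J]
    {flo f fhi : J → ℝ} {Blo B Bhi : ℝ} {Jt : I → Finset J} {y : J → ℝ} {z : I → ℝ}
    (h : MMFeas flo f fhi Blo B Bhi Jt y z) :
    FuzzyFeas flo f fhi Blo B Bhi Jt y z z z :=
  ⟨h.1, fun i => ⟨(h.2.1 i).1, le_rfl, le_rfl, (h.2.1 i).2⟩, h.2.2⟩

/-- If `(Y, Z)` is weakly Pareto for MMCLP and `(δ*, Y*, Z*)` is an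
optimal solution of the test problem `P(Y,Z)` with `δ*ᵣ > 0` for some `r`, then the crisp
fuzzy solution `(Y*, (Z*,Z*,Z*))` is a fuzzy Pareto solution of FMCLP. -/
theorem stmt_5 {I J : Type*} [Fintype I] [Fintype J]
    (wlo w whi : I → ℝ) (flo f fhi : J → ℝ) (Blo B Bhi : ℝ) (Jt : I → Finset J)
    (hw : ∀ i, 0 ≤ wlo i ∧ wlo i ≤ w i ∧ w i ≤ whi i)
    (Y : J → ℝ) (Z : I → ℝ)
    (hweak : MMWeakPareto wlo w whi flo f fhi Blo B Bhi Jt Y Z)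
    (d1 d2 d3 : ℝ) (Ys : J → ℝ) (Zs : I → ℝ)
    (hfeas : MMFeas flo f fhi Blo B Bhi Jt Ys Zs)
    (hd1 : 0 ≤ d1) (hd2 : 0 ≤ d2) (hd3 : 0 ≤ d3)
    (he1 : (∑ i, wlo i * Zs i) - d1 = ∑ i, wlo i * Z i)
    (he2 : (∑ i, w i * Zs i) - d2 = ∑ i, w i * Z i)
    (he3 : (∑ i, whi i * Zs i) - d3 = ∑ i, whi i * Z i)
    (hopt : ∀ (e1 e2 e3 : ℝ) (y : J → ℝ) (z : I → ℝ),
      MMFeas flo f fhi Blo B Bhi Jt y z →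
      0 ≤ e1 → 0 ≤ e2 → 0 ≤ e3 →
      (∑ i, wlo i * z i) - e1 = (∑ i, wlo i * Z i) →
      (∑ i, w i * z i) - e2 = (∑ i, w i * Z i) →
      (∑ i, whi i * z i) - e3 = (∑ i, whi i * Z i) →
      e1 + e2 + e3 ≤ d1 + d2 + d3)
    (hpos : 0 < d1 ∨ 0 < d2 ∨ 0 < d3) :
    FuzzyPareto wlo w whi flo f fhi Blo B Bhi Jt Ys Zs Zs Zs := by
  refine ⟨hfeas.fuzzyFeas, ?_⟩
  rintro ⟨y, zlo, zmid, zhi, hf, h1, h2, h3, hne⟩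
  have hlo : ∑ i, wlo i * zlo i ≤ ∑ i, wlo i * zhi i :=
    Finset.sum_le_sum fun i _ => mul_le_mul_of_nonneg_left
      ((hf.2.1 i).2.1.trans (hf.2.1 i).2.2.1) (hw i).1
  have hmid : ∑ i, w i * zmid i ≤ ∑ i, w i * zhi i :=
    Finset.sum_le_sum fun i _ => mul_le_mul_of_nonneg_left
      (hf.2.1 i).2.2.1 ((hw i).1.trans (hw i).2.1)
  have hsum := hopt (∑ i, wlo i * zhi i - ∑ i, wlo i * Z i)
    (∑ i, w i * zhi i - ∑ i, w i * Z i) (∑ i, whi i * zhi i - ∑ i, whi i * Z i)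
    y zhi hf.mmFeas_hi (by linarith) (by linarith) (by linarith)
    (sub_sub_cancel _ _) (sub_sub_cancel _ _) (sub_sub_cancel _ _)
  refine hne (Prod.ext ?_ (Prod.ext ?_ ?_)) <;> dsimp only <;> linarith
end

section
/- Let 0 ≤ a < b < c and 0 ≤ d < e < f be real numbers (two nonnegative triangular fuzzy numbers). Define the Zadeh (sup–min) product of two functions μ, ν : ℝ → ℝ by (μ ⊗ ν)(t) = sup {min(μ(x), ν(y)) : x, y ∈ ℝ, x·y = t}. Then for every α ∈ (0,1], the α-cut of the product satisfies {t ∈ ℝ : (tri(a,b,c) ⊗ tri(d,e,f))(t) ≥ α} = [(a + α(b−a))·(d + α(e−d)), (c − α(c−b))·(f − α(f−e))], the product of the two α-cut intervals. -/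
/-- The triangular membership function of the triangular fuzzy number `(a, b, c)`. -/
noncomputable def tri (a b c : ℝ) : ℝ → ℝ := fun x =>
  if a ≤ x ∧ x ≤ b then (x - a) / (b - a)
  else if b < x ∧ x ≤ c then (c - x) / (c - b)
  else 0

/-- The Zadeh (sup–min) product of two membership functions:
`(μ ⊗ ν)(t) = sup {min (μ x) (ν y) : x·y = t}`. -/
noncomputable def zadehProd (μ ν : ℝ → ℝ) : ℝ → ℝ := fun t =>
  sSup {m : ℝ | ∃ x y : ℝ, x * y = t ∧ m = min (μ x) (ν y)}

theorem le_tri_iff {a b c α : ℝ} (hab : a < b) (hbc : b < c) (hα : α ∈ Set.Ioc (0 : ℝ) 1)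
    (x : ℝ) : α ≤ tri a b c x ↔ a + α * (b - a) ≤ x ∧ x ≤ c - α * (c - b) := by
  obtain ⟨h0, h1⟩ := hα
  have hba : 0 < b - a := sub_pos.2 hab
  have hcb : 0 < c - b := sub_pos.2 hbc
  have p1 : 0 < α * (b - a) := mul_pos h0 hba
  have p2 : 0 < α * (c - b) := mul_pos h0 hcb
  have q1 : α * (b - a) ≤ b - a := mul_le_of_le_one_left hba.le h1
  have q2 : α * (c - b) ≤ c - b := mul_le_of_le_one_left hcb.le h1
  unfold tri
  split_ifs with h h'
  · rw [le_div_iff₀ hba]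
    constructor
    · intro _
      constructor <;> linarith [h.2]
    · rintro ⟨_, _⟩
      linarith
  · rw [le_div_iff₀ hcb]
    constructor
    · intro _
      constructor <;> linarith [h'.1]
    · rintro ⟨_, _⟩
      linarith
  · constructor
    · intro _
      linarith
    · rintro ⟨_, _⟩
      rcases le_or_gt x b with hx | hx
      · exact absurd ⟨by linarith, hx⟩ h
      · exact absurd ⟨hx, by linarith⟩ h'

theorem tri_le_one {a b c : ℝ} (hab : a < b) (hbc : b < c) (x : ℝ) : tri a b c x ≤ 1 := by
  unfold tri
  split_ifs with h h'
  · rw [div_le_one (sub_pos.2 hab)]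
    linarith [h.2]
  · rw [div_le_one (sub_pos.2 hbc)]
    linarith [h'.1]
  · exact zero_le_one

theorem exists_mul_eq_of_mem_Icc_mul {l₁ r₁ l₂ r₂ t : ℝ} (h₁ : l₁ ≤ r₁) (h₂ : l₂ ≤ r₂)
    (ht : t ∈ Set.Icc (l₁ * l₂) (r₁ * r₂)) :
    ∃ x ∈ Set.Icc l₁ r₁, ∃ y ∈ Set.Icc l₂ r₂, x * y = t := by
  have hcont : Continuous fun s : ℝ => (l₁ + s * (r₁ - l₁)) * (l₂ + s * (r₂ - l₂)) := by
    fun_prop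
  obtain ⟨s, ⟨hs0, hs1⟩, hs⟩ :=
    intermediate_value_Icc (zero_le_one' ℝ) hcont.continuousOn (by simpa using ht)
  exact ⟨_, ⟨by nlinarith, by nlinarith⟩, _, ⟨by nlinarith, by nlinarith⟩, hs⟩

theorem exists_lt_min_of_lt_zadehProd {μ ν : ℝ → ℝ} {β t : ℝ} (h : β < zadehProd μ ν t) :
    ∃ x y : ℝ, x * y = t ∧ β < μ x ∧ β < ν y := by
  obtain ⟨_, ⟨x, y, hxy, rfl⟩, hm⟩ :=
    exists_lt_of_lt_csSup (s := {m : ℝ | ∃ x y : ℝ, x * y = t ∧ m = min (μ x) (ν y)})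
      ⟨_, t, 1, mul_one t, rfl⟩ h
  exact ⟨x, y, hxy, lt_min_iff.1 hm⟩

theorem min_le_zadehProd {μ ν : ℝ → ℝ} {M : ℝ} (hμ : ∀ x, μ x ≤ M) (x y : ℝ) :
    min (μ x) (ν y) ≤ zadehProd μ ν (x * y) := by
  refine le_csSup ⟨M, ?_⟩ ⟨x, y, rfl, rfl⟩
  rintro _ ⟨u, v, -, rfl⟩
  exact (min_le_left _ _).trans (hμ u)

/-- For nonnegative triangular fuzzy numbers `(a,b,c)` and `(d,e,f)`
(with `0 ≤ a < b < c` and `0 ≤ d < e < f`) and any `α ∈ (0,1]`, the `α`-cut of their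
Zadeh product is the product of the two `α`-cut intervals. -/
theorem stmt_15 (a b c d e f : ℝ) (ha : 0 ≤ a) (hab : a < b) (hbc : b < c)
    (hd : 0 ≤ d) (hde : d < e) (hef : e < f)
    (α : ℝ) (hα : α ∈ Set.Ioc (0 : ℝ) 1) :
    {t : ℝ | α ≤ zadehProd (tri a b c) (tri d e f) t} =
      Set.Icc ((a + α * (b - a)) * (d + α * (e - d)))
        ((c - α * (c - b)) * (f - α * (f - e))) := by
  obtain ⟨h0, h1⟩ := hα
  ext t
  rw [Set.mem_ofPred_eq]
  constructor
  · intro h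
    have key : ∀ β ∈ Set.Ioo 0 α,
        (a + β * (b - a)) * (d + β * (e - d)) ≤ t ∧
          t ≤ (c - β * (c - b)) * (f - β * (f - e)) := by
      rintro β ⟨hβ0, hβα⟩
      have hβ : β ∈ Set.Ioc (0 : ℝ) 1 := ⟨hβ0, hβα.le.trans h1⟩
      obtain ⟨x, y, rfl, hx, hy⟩ := exists_lt_min_of_lt_zadehProd (hβα.trans_le h)
      obtain ⟨hx1, hx2⟩ := (le_tri_iff hab hbc hβ x).1 hx.le
      obtain ⟨hy1, hy2⟩ := (le_tri_iff hde hef hβ y).1 hy.le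
      have hl1 : 0 ≤ a + β * (b - a) := add_nonneg ha (mul_nonneg hβ0.le (by linarith))
      have hl2 : 0 ≤ d + β * (e - d) := add_nonneg hd (mul_nonneg hβ0.le (by linarith))
      exact ⟨mul_le_mul hx1 hy1 hl2 (hl1.trans hx1),
        mul_le_mul hx2 hy2 (hl2.trans hy1) ((hl1.trans hx1).trans hx2)⟩
    have hev : ∀ᶠ β in nhdsWithin α (Set.Iio α), β ∈ Set.Ioo 0 α := Ioo_mem_nhdsLT h0
    have hL : Continuous fun β : ℝ => (a + β * (b - a)) * (d + β * (e - d)) := by fun_prop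
    have hR : Continuous fun β : ℝ => (c - β * (c - b)) * (f - β * (f - e)) := by fun_prop
    exact ⟨le_of_tendsto (hL.continuousWithinAt (s := Set.Iio α))
        (hev.mono fun β hβ => (key β hβ).1),
      ge_of_tendsto (hR.continuousWithinAt (s := Set.Iio α))
        (hev.mono fun β hβ => (key β hβ).2)⟩
  · intro ht
    obtain ⟨x, hx, y, hy, rfl⟩ :=
      exists_mul_eq_of_mem_Icc_mul (by nlinarith) (by nlinarith) ht
    exact (le_min ((le_tri_iff hab hbc ⟨h0, h1⟩ x).2 hx)
      ((le_tri_iff hde hef ⟨h0, h1⟩ y).2 hy)).trans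
        (min_le_zadehProd (tri_le_one hab hbc) x y)
end
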